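/- Let u ∈ H^s₊(S¹) with s > 1/2, let σ ∈ Σ_K(u), and let p ∈ ℂ with |p| < 1; set χ_p(z) := (z − p)/(1 − conj(p) z). If f ∈ F_u(σ) = ker(K_u² − σ²I) is such that χ_p·f ∈ F_u(σ), then the commutator of the Toeplitz operator T_{|u|²} with multiplication by χ_p annihilates f: Π(|u|²·χ_p·f) = χ_p·Π(|u|²·f). -/

import Mathlib

open Complex Filter
open scoped ComplexConjugate Topology ENNReal

noncomputable section

/-- ℓ²(ℕ, ℂ): the sequence model of the Hardy space L²₊(S¹), identifying a function
with its sequence of nonnegative Fourier coefficients. -/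
abbrev Hardy : Type := lp (fun _ : ℕ => ℂ) 2

/-- A coefficient sequence belongs to L²₊. -/
def MemL2 (u : ℕ → ℂ) : Prop := Memℓp u 2

/-- A coefficient sequence belongs to the Sobolev space H^s₊. -/
def MemHs (s : ℝ) (u : ℕ → ℂ) : Prop :=
  Summable fun n : ℕ => ((1 : ℝ) + (n : ℝ) ^ 2) ^ s * ‖u n‖ ^ 2

/-- The squared H^s norm of a coefficient sequence. -/
def hsNormSq (s : ℝ) (u : ℕ → ℂ) : ℝ :=
  ∑' n : ℕ, ((1 : ℝ) + (n : ℝ) ^ 2) ^ s * ‖u n‖ ^ 2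

/-- The L² inner product (f|g), ℂ-linear in the first argument. -/
def hinner (f g : ℕ → ℂ) : ℂ := ∑' n : ℕ, f n * conj (g n)

/-- The squared L² norm. -/
def l2normSq (f : ℕ → ℂ) : ℝ := ∑' n : ℕ, ‖f n‖ ^ 2

/-- Coefficients of the constant function 1. -/
def oneSeq : ℕ → ℂ := fun n => if n = 0 then 1 else 0

/-- The Hankel operator H_u(h) = Π(u ⬝ conj h) in Fourier coefficients. -/
def hankel (u h : ℕ → ℂ) : ℕ → ℂ := fun k => ∑' ℓ : ℕ, u (k + ℓ) * conj (h ℓ)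

/-- The shifted Hankel operator K_u = T_z^* ∘ H_u in Fourier coefficients. -/
def khankel (u h : ℕ → ℂ) : ℕ → ℂ := fun k => ∑' ℓ : ℕ, u (k + 1 + ℓ) * conj (h ℓ)

/-- H_u². -/
def hu2 (u h : ℕ → ℂ) : ℕ → ℂ := hankel u (hankel u h)

/-- K_u². -/
def ku2 (u h : ℕ → ℂ) : ℕ → ℂ := khankel u (khankel u h)

/-- The m-th Fourier coefficient of |u|², m ∈ ℤ. -/
def absSqCoeff (u : ℕ → ℂ) (m : ℤ) : ℂ :=
  ∑' q : ℕ × ℕ, if ((q.1 : ℤ) - (q.2 : ℤ) = m) then u q.1 * conj (u q.2) else 0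

/-- The Toeplitz operator T_{|u|²} in Fourier coefficients. -/
def toeplitzAbsSq (u h : ℕ → ℂ) : ℕ → ℂ :=
  fun k => ∑' ℓ : ℕ, absSqCoeff u ((k : ℤ) - (ℓ : ℤ)) * h ℓ

/-- Fourier coefficients of Π(|u|²u). -/
def cubic (u : ℕ → ℂ) : ℕ → ℂ := fun n =>
  ∑' q : ℕ × ℕ × ℕ, if q.1 + q.2.2 = q.2.1 + n then u q.1 * conj (u q.2.1) * u q.2.2 else 0

/-- `u : ℝ → (ℕ → ℂ)` solves the α-Szegő equation i ∂ₜ u = Π(|u|²u) + α(u|1),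
written coefficientwise on nonnegative Fourier modes. -/
def SolvesSzego (α : ℝ) (u : ℝ → ℕ → ℂ) : Prop :=
  ∀ n t, HasDerivAt (fun τ => u τ n)
    (-Complex.I * (cubic (u t) n + (α : ℂ) * u t 0 * oneSeq n)) t

/-- `u` is a smooth curve valued in H^s₊. -/
def SmoothHsCurve (s : ℝ) (u : ℝ → ℕ → ℂ) : Prop :=
  (∀ t, MemHs s (u t)) ∧ ∀ n, ContDiff ℝ (⊤ : ℕ∞) fun t => u t n

/-- `u` is a continuous curve valued in H^s₊. -/
def ContHsCurve (s : ℝ) (u : ℝ → ℕ → ℂ) : Prop :=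
  (∀ t, MemHs s (u t)) ∧
    ∀ t₀ : ℝ, Tendsto (fun t => hsNormSq s (fun n => u t n - u t₀ n)) (𝓝 t₀) (𝓝 0)

/-- E_u(τ) = ker(H_u² − τ² I) as a subset of ℓ². -/
def Espace (u : ℕ → ℂ) (τ : ℝ) : Set (ℕ → ℂ) :=
  {h | MemL2 h ∧ hu2 u h = ((τ : ℂ) ^ 2) • h}

/-- F_u(τ) = ker(K_u² − τ² I) as a subset of ℓ². -/
def Fspace (u : ℕ → ℂ) (τ : ℝ) : Set (ℕ → ℂ) :=
  {h | MemL2 h ∧ ku2 u h = ((τ : ℂ) ^ 2) • h}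

/-- Σ_H(u): τ > 0 such that E_u(τ) is not orthogonal to u. -/
def SigmaH (u : ℕ → ℂ) : Set ℝ :=
  {τ : ℝ | 0 < τ ∧ ∃ v ∈ Espace u τ, hinner u v ≠ 0}

/-- Σ_K(u): τ ≥ 0 such that F_u(τ) is not orthogonal to u. -/
def SigmaK (u : ℕ → ℂ) : Set ℝ :=
  {τ : ℝ | 0 ≤ τ ∧ ∃ v ∈ Fspace u τ, hinner u v ≠ 0}

/-- `p` is the orthogonal projection of `w` on the subspace `V` of ℓ². -/
def IsOrthProj (V : Set (ℕ → ℂ)) (w p : ℕ → ℂ) : Prop :=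
  p ∈ V ∧ ∀ v ∈ V, hinner (w - p) v = 0

/-- The rank of the shifted Hankel operator K_u. -/
def kuRank (u : ℕ → ℂ) : Cardinal :=
  Module.rank ℂ (Submodule.span ℂ (khankel u '' {h | MemL2 h}))

/-- The rank of the Hankel operator H_u. -/
def huRank (u : ℕ → ℂ) : Cardinal :=
  Module.rank ℂ (Submodule.span ℂ (hankel u '' {h | MemL2 h}))

/-- ℒ(N) : rank K_u = N. -/
def InLN (N : ℕ) (u : ℕ → ℂ) : Prop := MemL2 u ∧ kuRank u = N

/-- The constant function 1 as an element of ℓ². -/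
def oneH : Hardy := lp.single 2 0 1


/-- Cauchy product of two Taylor-coefficient sequences (product of holomorphic functions). -/
def mulSeq (a b : ℕ → ℂ) : ℕ → ℂ := fun n => ∑ k ∈ Finset.range (n + 1), a k * b (n - k)

/-- Taylor coefficients of the Möbius factor χ_p(z) = (z − p)/(1 − conj(p) z), |p| < 1. -/
def chiCoeff (p : ℂ) : ℕ → ℂ := fun n =>
  if n = 0 then -p else (1 - p * conj p) * (conj p) ^ (n - 1)

lemma MemHs.summable_norm {s : ℝ} (hs : 1 / 2 < s) {u : ℕ → ℂ} (hu : MemHs s u) :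
    Summable fun n => ‖u n‖ := by
  have hw : Summable fun n : ℕ => ((1 : ℝ) + (n : ℝ) ^ 2) ^ (-s) := by
    rw [← summable_nat_add_iff 1]
    have h1 : Summable fun n : ℕ => ((n + 1 : ℕ) : ℝ) ^ (-(2 * s)) :=
      (summable_nat_add_iff 1).2 (Real.summable_nat_rpow.2 (by linarith))
    refine h1.of_nonneg_of_le (fun n => by positivity) fun n => ?_
    have hn : (0 : ℝ) < ((n + 1 : ℕ) : ℝ) := by positivity
    have h2 : ((n + 1 : ℕ) : ℝ) ^ (-(2 * s)) = (((n + 1 : ℕ) : ℝ) ^ 2) ^ (-s) := by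
      rw [← Real.rpow_natCast, ← Real.rpow_mul hn.le]
      norm_num
    rw [h2]
    exact Real.rpow_le_rpow_of_nonpos (by positivity) (by linarith) (by linarith)
  refine (Summable.add hu hw).of_nonneg_of_le (fun n => norm_nonneg _) fun n => ?_
  have hpos : (0 : ℝ) < 1 + (n : ℝ) ^ 2 := by positivity
  have ha : 0 < ((1 : ℝ) + (n : ℝ) ^ 2) ^ s := Real.rpow_pos_of_pos hpos s
  have hb : 0 < ((1 : ℝ) + (n : ℝ) ^ 2) ^ (-s) := Real.rpow_pos_of_pos hpos (-s)
  have hab : ((1 : ℝ) + (n : ℝ) ^ 2) ^ s * ((1 : ℝ) + (n : ℝ) ^ 2) ^ (-s) = 1 := by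
    rw [← Real.rpow_add hpos]
    simp
  set a := ((1 : ℝ) + (n : ℝ) ^ 2) ^ s
  set b := ((1 : ℝ) + (n : ℝ) ^ 2) ^ (-s)
  have hx := norm_nonneg (u n)
  by_contra! h
  nlinarith [sq_nonneg (a * ‖u n‖ - b), sq_nonneg (a * ‖u n‖ + b - ‖u n‖),
    mul_pos ha hb, mul_nonneg ha.le hx, mul_nonneg hb.le hx, sq_nonneg (a * ‖u n‖ ^ 2 - b),
    mul_nonneg ha.le (sq_nonneg ‖u n‖)]

lemma MemL2.summable_sq {f : ℕ → ℂ} (hf : MemL2 f) : Summable fun n => ‖f n‖ ^ 2 := by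
  have h := Memℓp.summable (p := 2) (by norm_num) hf
  simpa using h

lemma exists_norm_le_of_summable_sq {f : ℕ → ℂ} (hf : Summable fun n => ‖f n‖ ^ 2) :
    ∃ C, ∀ n, ‖f n‖ ≤ C := by
  refine ⟨1 + ∑' n, ‖f n‖ ^ 2, fun n => ?_⟩
  have h := hf.le_tsum n fun _ _ => by positivity
  nlinarith [sq_nonneg (‖f n‖ - 1)]

lemma summable_mul_conj {u f : ℕ → ℂ} (hu : Summable fun n => ‖u n‖)
    (hf : Summable fun n => ‖f n‖ ^ 2) : Summable fun n => u n * conj (f n) := by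
  obtain ⟨C, hC⟩ := exists_norm_le_of_summable_sq hf
  refine Summable.of_norm_bounded (hu.mul_right C) fun n => ?_
  rw [norm_mul, RCLike.norm_conj]
  exact mul_le_mul_of_nonneg_left (hC n) (norm_nonneg _)

lemma summable_norm_shift {u : ℕ → ℂ} (hu : Summable fun n => ‖u n‖) (k : ℕ) :
    Summable fun n => ‖u (k + n)‖ :=
  hu.comp_injective (add_right_injective k)

lemma summable_khankel {u f : ℕ → ℂ} (hu : Summable fun n => ‖u n‖)
    (hf : Summable fun n => ‖f n‖ ^ 2) (k : ℕ) :
    Summable fun n => u (k + 1 + n) * conj (f n) :=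
  summable_mul_conj (summable_norm_shift hu (k + 1)) hf

lemma tsum_norm_shift_le {u : ℕ → ℂ} (hu : Summable fun n => ‖u n‖) (k : ℕ) :
    ∑' n, ‖u (k + n)‖ ≤ ∑' n, ‖u n‖ :=
  Summable.tsum_le_tsum_of_inj (fun n => k + n) (add_right_injective k)
    (fun _ _ => norm_nonneg _) (fun _ => le_rfl) (summable_norm_shift hu k) hu

lemma summable_kernel_mul_sq {u f : ℕ → ℂ} (hu : Summable fun n => ‖u n‖)
    (hf : Summable fun n => ‖f n‖ ^ 2) :
    Summable fun q : ℕ × ℕ => ‖u (q.1 + 1 + q.2)‖ * ‖f q.1‖ ^ 2 := by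
  rw [summable_prod_of_nonneg
    (fun q => mul_nonneg (norm_nonneg (u (q.1 + 1 + q.2))) (sq_nonneg ‖f q.1‖))]
  refine ⟨fun k => (summable_norm_shift hu (k + 1)).mul_right (‖f k‖ ^ 2), ?_⟩
  refine (hf.mul_left (∑' n, ‖u n‖)).of_nonneg_of_le
    (fun k => tsum_nonneg fun _ => by positivity) fun k => ?_
  dsimp only
  rw [tsum_mul_right]
  exact mul_le_mul_of_nonneg_right (tsum_norm_shift_le hu (k + 1)) (by positivity)

lemma summable_kernel_mul_sq_swap {u f : ℕ → ℂ} (hu : Summable fun n => ‖u n‖)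
    (hf : Summable fun n => ‖f n‖ ^ 2) :
    Summable fun q : ℕ × ℕ => ‖u (q.1 + 1 + q.2)‖ * ‖f q.2‖ ^ 2 := by
  refine ((Equiv.prodComm ℕ ℕ).summable_iff.2 (summable_kernel_mul_sq hu hf)).congr fun q => ?_
  simp only [Function.comp, Equiv.prodComm_apply, Prod.fst_swap, Prod.snd_swap]
  rw [show q.2 + 1 + q.1 = q.1 + 1 + q.2 by ring]

lemma sq_tsum_mul_le {a b : ℕ → ℝ} (ha : ∀ n, 0 ≤ a n) (hb : ∀ n, 0 ≤ b n)
    (hsa : Summable a) (hsb : Summable fun n => a n * b n ^ 2) :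
    (∑' n, a n * b n) ^ 2 ≤ (∑' n, a n) * ∑' n, a n * b n ^ 2 := by
  have h1 : ∀ n, √(a n) ^ (2 : ℝ) = a n := fun n => by
    rw [Real.rpow_two, Real.sq_sqrt (ha n)]
  have h2 : ∀ n, (√(a n) * b n) ^ (2 : ℝ) = a n * b n ^ 2 := fun n => by
    rw [Real.rpow_two, mul_pow, Real.sq_sqrt (ha n)]
  have h := Real.inner_le_Lp_mul_Lq_tsum_of_nonneg (f := fun n => √(a n))
    (g := fun n => √(a n) * b n) Real.HolderConjugate.two_two (fun n => Real.sqrt_nonneg _)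
    (fun n => mul_nonneg (Real.sqrt_nonneg _) (hb n)) (by simpa only [h1] using hsa)
    (by simpa only [h2] using hsb)
  simp only [h1, h2, ← mul_assoc, Real.mul_self_sqrt (ha _), ← Real.sqrt_eq_rpow] at h
  have h0 : 0 ≤ ∑' n, a n * b n := tsum_nonneg fun n => mul_nonneg (ha n) (hb n)
  calc (∑' n, a n * b n) ^ 2 ≤ (√(∑' n, a n) * √(∑' n, a n * b n ^ 2)) ^ 2 :=
        pow_le_pow_left₀ h0 h 2
    _ = _ := by
        rw [mul_pow, Real.sq_sqrt (tsum_nonneg ha),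
          Real.sq_sqrt (tsum_nonneg fun n => mul_nonneg (ha n) (sq_nonneg _))]

lemma summable_sq_khankel {u f : ℕ → ℂ} (hu : Summable fun n => ‖u n‖)
    (hf : Summable fun n => ‖f n‖ ^ 2) : Summable fun n => ‖khankel u f n‖ ^ 2 := by
  have hs := summable_kernel_mul_sq_swap hu hf
  refine (hs.prod.mul_left (∑' n, ‖u n‖)).of_nonneg_of_le (fun k => by positivity) fun k => ?_
  have hk := summable_khankel hu hf k
  have h1 : ‖khankel u f k‖ ≤ ∑' n, ‖u (k + 1 + n)‖ * ‖f n‖ := by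
    refine (norm_tsum_le_tsum_norm hk.norm).trans_eq ?_
    simp only [norm_mul, RCLike.norm_conj]
  refine (pow_le_pow_left₀ (norm_nonneg _) h1 2).trans ?_
  refine (sq_tsum_mul_le (fun n => norm_nonneg _) (fun n => norm_nonneg _)
    (summable_norm_shift hu (k + 1)) (hs.prod_factor k)).trans ?_
  exact mul_le_mul_of_nonneg_right (tsum_norm_shift_le hu (k + 1))
    (tsum_nonneg fun _ => by positivity)

/-- `(K_u g | f) = (K_u f | g)`. -/
lemma hinner_khankel_comm {u f g : ℕ → ℂ} (hu : Summable fun n => ‖u n‖)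
    (hf : Summable fun n => ‖f n‖ ^ 2) (hg : Summable fun n => ‖g n‖ ^ 2) :
    hinner (khankel u g) f = hinner (khankel u f) g := by
  have hs : Summable fun q : ℕ × ℕ => u (q.1 + 1 + q.2) * conj (g q.2) * conj (f q.1) := by
    refine Summable.of_norm_bounded
      ((summable_kernel_mul_sq hu hf).add (summable_kernel_mul_sq_swap hu hg)) fun q => ?_
    rw [norm_mul, norm_mul, RCLike.norm_conj, RCLike.norm_conj]
    have : ‖g q.2‖ * ‖f q.1‖ ≤ ‖f q.1‖ ^ 2 + ‖g q.2‖ ^ 2 := by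
      nlinarith [sq_nonneg (‖g q.2‖ - ‖f q.1‖), sq_nonneg (‖g q.2‖ + ‖f q.1‖)]
    nlinarith [mul_le_mul_of_nonneg_left this (norm_nonneg (u (q.1 + 1 + q.2)))]
  simp only [hinner, khankel, ← tsum_mul_right]
  rw [← Summable.tsum_comm (f := fun k n => u (k + 1 + n) * conj (g n) * conj (f k)) hs]
  refine tsum_congr fun n => tsum_congr fun k => ?_
  rw [add_right_comm k 1 n, add_right_comm n 1 k, add_comm k n]
  ring

lemma hinner_self (f : ℕ → ℂ) : hinner f f = ((∑' n, ‖f n‖ ^ 2 : ℝ) : ℂ) := by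
  simp only [hinner, Complex.mul_conj, Complex.normSq_eq_norm_sq, Complex.ofReal_tsum]

lemma tsum_sq_khankel {u f : ℕ → ℂ} (hu : Summable fun n => ‖u n‖)
    (hf : Summable fun n => ‖f n‖ ^ 2) {σ : ℝ} (h : ku2 u f = ((σ : ℂ) ^ 2) • f) :
    ∑' n, ‖khankel u f n‖ ^ 2 = σ ^ 2 * ∑' n, ‖f n‖ ^ 2 := by
  have h1 := hinner_khankel_comm hu hf (summable_sq_khankel hu hf)
  rw [hinner_self, ← ku2, h] at h1
  have h2 : hinner (((σ : ℂ) ^ 2) • f) f = (σ : ℂ) ^ 2 * hinner f f := by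
    simp only [hinner, Pi.smul_apply, smul_eq_mul, mul_assoc, tsum_mul_left]
  rw [h2, hinner_self] at h1
  exact_mod_cast h1.symm

lemma mulSeq_chiCoeff_zero (p : ℂ) (f : ℕ → ℂ) : mulSeq (chiCoeff p) f 0 = -p * f 0 := by
  simp [mulSeq, chiCoeff]

/-- `(1 - conj p z) χ_p f = (z - p) f`, coefficientwise. -/
lemma mulSeq_chiCoeff_succ (p : ℂ) (f : ℕ → ℂ) (n : ℕ) :
    mulSeq (chiCoeff p) f (n + 1) =
      conj p * mulSeq (chiCoeff p) f n + f n - p * f (n + 1) := by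
  simp only [mulSeq]
  rw [Finset.sum_range_succ', Finset.sum_range_succ', Finset.sum_range_succ' _ n, mul_add,
    Finset.mul_sum]
  have h : ∀ k ∈ Finset.range n, chiCoeff p (k + 1 + 1) * f (n + 1 - (k + 1 + 1)) =
      conj p * (chiCoeff p (k + 1) * f (n - (k + 1))) := fun k _ => by
    simp only [chiCoeff, Nat.add_sub_add_right]
    simp [pow_succ]
    ring
  rw [Finset.sum_congr rfl h]
  simp [chiCoeff]
  ring

lemma eq_mulSeq_chiCoeff {p : ℂ} {X Y : ℕ → ℂ} (h0 : X 0 = -p * Y 0)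
    (h : ∀ n, X (n + 1) = conj p * X n + Y n - p * Y (n + 1)) :
    X = mulSeq (chiCoeff p) Y := by
  funext n
  induction n with
  | zero => rw [h0, mulSeq_chiCoeff_zero]
  | succ n ih => rw [h, mulSeq_chiCoeff_succ, ih]

lemma norm_add_mul_sq_sub (p a b : ℂ) :
    ‖a + p * b‖ ^ 2 - ‖b + conj p * a‖ ^ 2 = (1 - ‖p‖ ^ 2) * (‖a‖ ^ 2 - ‖b‖ ^ 2) := by
  simp only [← Complex.normSq_eq_norm_sq, Complex.normSq_apply, Complex.add_re, Complex.add_im,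
    Complex.mul_re, Complex.mul_im, Complex.conj_re, Complex.conj_im]
  ring

lemma summable_sq_add_mul {f g : ℕ → ℂ} (hf : Summable fun n => ‖f n‖ ^ 2)
    (hg : Summable fun n => ‖g n‖ ^ 2) (p : ℂ) : Summable fun n => ‖f n + p * g n‖ ^ 2 := by
  refine ((hf.mul_left 2).add (hg.mul_left (2 * ‖p‖ ^ 2))).of_nonneg_of_le
    (fun _ => by positivity) fun n => ?_
  have h := pow_le_pow_left₀ (norm_nonneg _) (norm_add_le (f n) (p * g n)) 2
  rw [norm_mul] at h
  nlinarith [sq_nonneg (‖f n‖ - ‖p‖ * ‖g n‖)]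

lemma tsum_sq_add_mul_sub {f g : ℕ → ℂ} (hf : Summable fun n => ‖f n‖ ^ 2)
    (hg : Summable fun n => ‖g n‖ ^ 2) (p : ℂ) :
    ∑' n, ‖g n + p * f n‖ ^ 2 - ∑' n, ‖f n + conj p * g n‖ ^ 2 =
      (1 - ‖p‖ ^ 2) * (∑' n, ‖g n‖ ^ 2 - ∑' n, ‖f n‖ ^ 2) := by
  rw [← (summable_sq_add_mul hg hf p).tsum_sub (summable_sq_add_mul hf hg _),
    ← hg.tsum_sub hf, ← tsum_mul_left]
  exact tsum_congr fun n => norm_add_mul_sq_sub p _ _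

/-- Multiplication by `χ_p` is isometric on `L²₊`. -/
lemma tsum_sq_mulSeq_chiCoeff {p : ℂ} (hp : ‖p‖ < 1) {f : ℕ → ℂ}
    (hf : Summable fun n => ‖f n‖ ^ 2)
    (hF : Summable fun n => ‖mulSeq (chiCoeff p) f n‖ ^ 2) :
    ∑' n, ‖mulSeq (chiCoeff p) f n‖ ^ 2 = ∑' n, ‖f n‖ ^ 2 := by
  have h := tsum_sq_add_mul_sub hf hF p
  rw [(summable_sq_add_mul hF hf p).tsum_eq_zero_add] at h
  have h1 : ∀ n, mulSeq (chiCoeff p) f (n + 1) + p * f (n + 1) =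
      f n + conj p * mulSeq (chiCoeff p) f n := fun n => by
    rw [mulSeq_chiCoeff_succ]; ring
  simp only [h1, mulSeq_chiCoeff_zero] at h
  have h2 : (1 - ‖p‖ ^ 2) *
      (∑' n, ‖mulSeq (chiCoeff p) f n‖ ^ 2 - ∑' n, ‖f n‖ ^ 2) = 0 := by
    rw [← h]; simp
  have h3 : (1 : ℝ) - ‖p‖ ^ 2 ≠ 0 := by nlinarith [norm_nonneg p]
  exact sub_eq_zero.1 ((mul_eq_zero.1 h2).resolve_left h3)

lemma khankel_mulSeq_chiCoeff {u f : ℕ → ℂ} (hu : Summable fun n => ‖u n‖) {p : ℂ}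
    (hf : Summable fun n => ‖f n‖ ^ 2)
    (hF : Summable fun n => ‖mulSeq (chiCoeff p) f n‖ ^ 2) (k : ℕ) :
    khankel u (mulSeq (chiCoeff p) f) k + conj p * khankel u f k =
      khankel u f (k + 1) + p * khankel u (mulSeq (chiCoeff p) f) (k + 1) := by
  simp only [khankel, ← tsum_mul_left]
  rw [← (summable_khankel hu hF k).tsum_add ((summable_khankel hu hf k).mul_left _),
    ← (summable_khankel hu hf (k + 1)).tsum_add ((summable_khankel hu hF (k + 1)).mul_left _),
    ((summable_khankel hu hF k).add ((summable_khankel hu hf k).mul_left _)).tsum_eq_zero_add,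
    mulSeq_chiCoeff_zero]
  have h0 : u (k + 1 + 0) * conj (-p * f 0) + conj p * (u (k + 1 + 0) * conj (f 0)) = 0 := by
    simp; ring
  rw [h0, zero_add]
  refine tsum_congr fun n => ?_
  rw [mulSeq_chiCoeff_succ, show k + 1 + (n + 1) = k + 1 + 1 + n by ring]
  simp
  ring

lemma hinner_khankel_mulSeq_chiCoeff {u f : ℕ → ℂ} (hu : Summable fun n => ‖u n‖) {p : ℂ}
    (hp : ‖p‖ < 1) {σ : ℝ} (hf : f ∈ Fspace u σ) (hF : mulSeq (chiCoeff p) f ∈ Fspace u σ) :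
    hinner u (khankel u f) + conj p * hinner u (khankel u (mulSeq (chiCoeff p) f)) = 0 := by
  have hf2 := hf.1.summable_sq
  have hF2 := hF.1.summable_sq
  have hg2 := summable_sq_khankel hu hf2
  have hG2 := summable_sq_khankel hu hF2
  have hnorm : ∑' n, ‖khankel u (mulSeq (chiCoeff p) f) n‖ ^ 2 =
      ∑' n, ‖khankel u f n‖ ^ 2 := by
    rw [tsum_sq_khankel hu hf2 hf.2, tsum_sq_khankel hu hF2 hF.2,
      tsum_sq_mulSeq_chiCoeff hp hf2 hF2]
  have hshift := khankel_mulSeq_chiCoeff hu hf2 hF2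
  have hKG : khankel u (khankel u (mulSeq (chiCoeff p) f)) 0 + p * khankel u (khankel u f) 0
      = 0 := by
    have h1 := congrFun hf.2 0
    have h2 := congrFun hF.2 0
    simp only [ku2, Pi.smul_apply, smul_eq_mul, mulSeq_chiCoeff_zero] at h1 h2
    rw [h1, h2]; ring
  set g := khankel u f
  set G := khankel u (mulSeq (chiCoeff p) f)
  have hy0 : g 0 + p * G 0 = 0 := by
    have h := tsum_sq_add_mul_sub hG2 hg2 p
    rw [hnorm, sub_self, mul_zero, (summable_sq_add_mul hg2 hG2 p).tsum_eq_zero_add] at h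
    simp only [hshift] at h
    rw [add_sub_cancel_right] at h
    simpa using h
  simp only [khankel, zero_add] at hKG
  rw [← tsum_mul_left, ← Summable.tsum_add] at hKG
  · simp only [hinner]
    rw [← tsum_mul_left, ← (summable_mul_conj hu hg2).tsum_add
      ((summable_mul_conj hu hG2).mul_left _),
      ((summable_mul_conj hu hg2).add ((summable_mul_conj hu hG2).mul_left _)).tsum_eq_zero_add]
    have h0 : u 0 * conj (g 0) + conj p * (u 0 * conj (G 0)) = u 0 * conj (g 0 + p * G 0) := by
      simp; ring
    rw [h0, hy0, map_zero, mul_zero, zero_add, ← hKG]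
    refine tsum_congr fun n => ?_
    have h := congrArg conj (hshift n)
    simp only [map_add, map_mul, Complex.conj_conj] at h
    rw [add_comm 1 n]
    linear_combination -u (n + 1) * h
  · simpa using summable_khankel hu hG2 0
  · simpa using (summable_khankel hu hg2 0).mul_left p

/-- The coefficient of index `k ∈ ℤ` of `|u|² h`. -/
def absSqMulCoeff (u h : ℕ → ℂ) (k : ℤ) : ℂ := ∑' ℓ : ℕ, absSqCoeff u (k - ℓ) * h ℓ

lemma summable_absSqCoeff_mul {u h : ℕ → ℂ} (hu : Summable fun n => ‖u n‖)
    (hh : Summable fun n => ‖h n‖ ^ 2) (k : ℤ) :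
    Summable fun ℓ : ℕ => absSqCoeff u (k - ℓ) * h ℓ := by
  obtain ⟨C, hC⟩ := exists_norm_le_of_summable_sq hh
  have hq : Summable fun q : ℕ × ℕ => ‖u q.1‖ * ‖u q.2‖ :=
    hu.mul_of_nonneg hu (fun _ => norm_nonneg _) fun _ => norm_nonneg _
  have hs : Summable fun r : (ℕ × ℕ) × ℕ =>
      if ((r.1.1 : ℤ) - r.1.2 = k - r.2) then ‖u r.1.1‖ * ‖u r.1.2‖ else 0 := by
    have hsupp : ∀ q : ℕ × ℕ, ∀ ℓ ≠ (k - q.1 + q.2).toNat,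
        (if ((q.1 : ℤ) - q.2 = k - (ℓ : ℕ)) then ‖u q.1‖ * ‖u q.2‖ else 0) = 0 :=
      fun q ℓ hℓ => if_neg fun h => hℓ (by omega)
    rw [summable_prod_of_nonneg (fun r => by dsimp only; split_ifs <;> positivity)]
    refine ⟨fun q => (hasSum_single _ (hsupp q)).summable, ?_⟩
    refine hq.of_nonneg_of_le
      (fun q => tsum_nonneg fun ℓ => by dsimp only; split_ifs <;> positivity) fun q => ?_
    dsimp only
    rw [tsum_eq_single _ (hsupp q)]
    split_ifs
    · exact le_rfl
    · positivity
  have hs' := (Equiv.prodComm ℕ (ℕ × ℕ)).summable_iff.2 hs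
  refine Summable.of_norm_bounded (hs'.prod.mul_right C) fun ℓ => ?_
  rw [norm_mul]
  refine mul_le_mul ?_ (hC ℓ) (norm_nonneg _) (tsum_nonneg fun q => by
    simp only [Function.comp, Equiv.prodComm_apply, Prod.swap]; split_ifs <;> positivity)
  refine tsum_of_norm_bounded (hs'.prod_factor ℓ).hasSum fun q => ?_
  simp only [Function.comp, Equiv.prodComm_apply, Prod.swap]
  split_ifs with hq <;> simp [hq]

lemma absSqCoeff_neg (u : ℕ → ℂ) (ℓ : ℕ) :
    absSqCoeff u (-1 - ℓ) = ∑' q : ℕ, u q * conj (u (q + 1 + ℓ)) := by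
  have hinj : Function.Injective fun q : ℕ => (q, q + 1 + ℓ) := fun a b h => (Prod.ext_iff.1 h).1
  rw [absSqCoeff, ← hinj.tsum_eq]
  · refine tsum_congr fun q => ?_
    rw [if_pos (by push_cast; ring)]
  · intro q hq
    have h : (q.1 : ℤ) - q.2 = -1 - ℓ := by
      by_contra h
      exact hq (if_neg h)
    exact ⟨q.1, Prod.ext rfl (by simp only; omega)⟩

lemma absSqMulCoeff_neg_one {u h : ℕ → ℂ} (hu : Summable fun n => ‖u n‖)
    (hh : Summable fun n => ‖h n‖ ^ 2) :
    absSqMulCoeff u h (-1) = hinner u (khankel u h) := by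
  obtain ⟨C, hC⟩ := exists_norm_le_of_summable_sq hh
  have hq : Summable fun q : ℕ × ℕ => ‖u q.1‖ * ‖u q.2‖ :=
    hu.mul_of_nonneg hu (fun _ => norm_nonneg _) fun _ => norm_nonneg _
  have hinj : Function.Injective fun r : ℕ × ℕ => (r.2, r.2 + 1 + r.1) := fun a b h => by
    simp only [Prod.mk.injEq] at h
    exact Prod.ext (by omega) h.1
  have hs : Summable fun r : ℕ × ℕ => u r.2 * conj (u (r.2 + 1 + r.1)) * h r.1 := by
    refine Summable.of_norm_bounded ((hq.comp_injective hinj).mul_right C) fun r => ?_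
    rw [norm_mul, norm_mul, RCLike.norm_conj]
    exact mul_le_mul_of_nonneg_left (hC _) (by positivity)
  simp only [absSqMulCoeff, absSqCoeff_neg, ← tsum_mul_right]
  rw [← Summable.tsum_comm (f := fun ℓ q => u q * conj (u (q + 1 + ℓ)) * h ℓ) hs]
  simp only [hinner, khankel]
  refine tsum_congr fun q => ?_
  rw [Complex.conj_tsum, ← tsum_mul_left]
  refine tsum_congr fun ℓ => ?_
  simp
  ring

lemma absSqMulCoeff_mulSeq_chiCoeff {u f : ℕ → ℂ} (hu : Summable fun n => ‖u n‖) {p : ℂ}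
    (hf : Summable fun n => ‖f n‖ ^ 2)
    (hF : Summable fun n => ‖mulSeq (chiCoeff p) f n‖ ^ 2) (k : ℤ) :
    absSqMulCoeff u (mulSeq (chiCoeff p) f) (k + 1) + p * absSqMulCoeff u f (k + 1) =
      conj p * absSqMulCoeff u (mulSeq (chiCoeff p) f) k + absSqMulCoeff u f k := by
  have sf := summable_absSqCoeff_mul hu hf
  have sF := summable_absSqCoeff_mul hu hF
  simp only [absSqMulCoeff, ← tsum_mul_left]
  rw [← (sF (k + 1)).tsum_add ((sf (k + 1)).mul_left _),
    ← ((sF k).mul_left _).tsum_add (sf k),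
    ((sF (k + 1)).add ((sf (k + 1)).mul_left _)).tsum_eq_zero_add, mulSeq_chiCoeff_zero]
  have h0 : absSqCoeff u (k + 1 - (0 : ℕ)) * (-p * f 0) +
      p * (absSqCoeff u (k + 1 - (0 : ℕ)) * f 0) = 0 := by ring
  rw [h0, zero_add]
  refine tsum_congr fun n => ?_
  rw [mulSeq_chiCoeff_succ, show k + 1 - ((n + 1 : ℕ) : ℤ) = k - n by push_cast; ring]
  ring

/-- If `σ ∈ Σ_K(u)`, `|p| < 1` and both `f` and `χ_p f` belong to
`F_u(σ)`, then the commutator `[T_{|u|²}, χ_p]` annihilates `f`: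
`Π(|u|² χ_p f) = χ_p Π(|u|² f)`. -/
theorem toeplitz_commutator_annihilates (s : ℝ) (hs : 1/2 < s) (u : ℕ → ℂ)
    (hu : MemHs s u) (σ : ℝ) (hσ : σ ∈ SigmaK u) (p : ℂ) (hp : ‖p‖ < 1)
    (f : ℕ → ℂ) (hf : f ∈ Fspace u σ) (hχf : mulSeq (chiCoeff p) f ∈ Fspace u σ) :
    toeplitzAbsSq u (mulSeq (chiCoeff p) f) = mulSeq (chiCoeff p) (toeplitzAbsSq u f) := by
  have hu1 := hu.summable_norm hs
  have hf2 := hf.1.summable_sq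
  have hF2 := hχf.1.summable_sq
  have hrec := absSqMulCoeff_mulSeq_chiCoeff hu1 hf2 hF2
  refine eq_mulSeq_chiCoeff ?_ fun n => ?_
  · have h := hrec (-1)
    have horth := hinner_khankel_mulSeq_chiCoeff hu1 hp hf hχf
    rw [absSqMulCoeff_neg_one hu1 hf2, absSqMulCoeff_neg_one hu1 hF2, neg_add_cancel] at h
    have h' : toeplitzAbsSq u (mulSeq (chiCoeff p) f) 0 + p * toeplitzAbsSq u f 0 = _ := h
    linear_combination h' + horth
  · have h := hrec n
    have h' : toeplitzAbsSq u (mulSeq (chiCoeff p) f) (n + 1) + p * toeplitzAbsSq u f (n + 1) =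
      conj p * toeplitzAbsSq u (mulSeq (chiCoeff p) f) n + toeplitzAbsSq u f n := h
    linear_combination h'


end
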